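/- Let d ≥ 1 be an integer, 1 < p < ∞, m a nonnegative integer with m > d/p, and δ_1, δ_2 ∈ ℝ. Then there exists a constant C > 0 such that for all f, g ∈ C_c^∞(ℝ^d) one has ‖f·g‖_{W^{m,p}_{δ_1+δ_2+d/p}} ≤ C ‖f‖_{W^{m,p}_{δ_1}} ‖g‖_{W^{m,p}_{δ_2}}, where f·g denotes the pointwise product. -/

import Mathlib

open MeasureTheory

/-- Partial derivative in direction `j`. -/
noncomputable def pd {d : ℕ} (j : Fin d) (f : (Fin d → ℝ) → ℝ) : (Fin d → ℝ) → ℝ :=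
  fun x => fderiv ℝ f x (Pi.single j 1)

/-- Iterated partial derivative `∂^α`. -/
noncomputable def pdm {d : ℕ} (α : Fin d → ℕ) (f : (Fin d → ℝ) → ℝ) : (Fin d → ℝ) → ℝ :=
  (List.finRange d).foldr (fun j g => (pd j)^[α j] g) f

/-- Japanese bracket `⟨x⟩ = (1+|x|²)^{1/2}` with the Euclidean norm. -/
noncomputable def jap {d : ℕ} (x : Fin d → ℝ) : ℝ := Real.sqrt (1 + ∑ i, x i ^ 2)

/-- The weighted Sobolev norm `‖f‖_{W^{m,p}_δ}`. -/
noncomputable def wnorm (d m : ℕ) (p δ : ℝ) (f : (Fin d → ℝ) → ℝ) : ℝ :=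
  ∑ β : Fin d → Fin (m + 1),
    if (∑ j, (β j : ℕ)) ≤ m then
      (∫ x : Fin d → ℝ,
        jap x ^ ((δ + ((∑ j, (β j : ℕ)) : ℝ)) * p) *
          |pdm (fun j => (β j : ℕ)) f x| ^ p) ^ (1 / p)
    else 0

open scoped ENNReal


noncomputable def pdl {d : ℕ} (L : List (Fin d)) (f : (Fin d → ℝ) → ℝ) : (Fin d → ℝ) → ℝ :=
  L.foldr pd f

lemma pd_smooth {d : ℕ} (j : Fin d) {f : (Fin d → ℝ) → ℝ} (hf : ContDiff ℝ (⊤ : ℕ∞) f) :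
    ContDiff ℝ (⊤ : ℕ∞) (pd j f) := by
  unfold pd
  have : ContDiff ℝ (⊤ : ℕ∞) (fderiv ℝ f) := hf.fderiv_right (by simp)
  exact this.clm_apply contDiff_const

lemma pdl_smooth {d : ℕ} (L : List (Fin d)) {f : (Fin d → ℝ) → ℝ}
    (hf : ContDiff ℝ (⊤ : ℕ∞) f) : ContDiff ℝ (⊤ : ℕ∞) (pdl L f) := by
  induction L with
  | nil => exact hf
  | cons j L ih => exact pd_smooth j ih

lemma pd_comm {d : ℕ} (i j : Fin d) {f : (Fin d → ℝ) → ℝ} (hf : ContDiff ℝ (⊤ : ℕ∞) f) :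
    pd i (pd j f) = pd j (pd i f) := by
  have h1 : ContDiff ℝ (⊤ : ℕ∞) (fderiv ℝ f) := hf.fderiv_right (by simp)
  have h2 : Differentiable ℝ (fderiv ℝ f) := h1.differentiable (by simp)
  funext x
  have key : ∀ a b : Fin d, pd a (pd b f) x
      = fderiv ℝ (fderiv ℝ f) x (Pi.single a 1) (Pi.single b 1) := by
    intro a b
    unfold pd
    rw [fderiv_clm_apply (h2 x) (differentiableAt_const _)]
    simp
  rw [key, key]
  have hs : IsSymmSndFDerivAt ℝ f x := by
    apply ContDiffAt.isSymmSndFDerivAt (hf.contDiffAt)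
    simp only [minSmoothness_of_isRCLikeNormedField]
    exact WithTop.coe_le_coe.2 (le_top : (2 : ℕ∞) ≤ ⊤)
  exact hs _ _

lemma pdl_perm {d : ℕ} {L L' : List (Fin d)} (h : L.Perm L') {f : (Fin d → ℝ) → ℝ}
    (hf : ContDiff ℝ (⊤ : ℕ∞) f) : pdl L f = pdl L' f := by
  induction h with
  | nil => rfl
  | cons x h ih => exact congrArg (pd x) ih
  | swap x y l => exact pd_comm _ _ (pdl_smooth l hf)
  | trans h1 h2 ih1 ih2 => exact ih1.trans ih2

lemma pdl_apply {d : ℕ} (L : List (Fin d)) {f : (Fin d → ℝ) → ℝ}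
    (hf : ContDiff ℝ (⊤ : ℕ∞) f) (x : Fin d → ℝ) :
    pdl L f x = iteratedFDeriv ℝ L.length f x (fun i => Pi.single (L.get i) (1 : ℝ)) := by
  induction L generalizing x with
  | nil => simp [pdl]
  | cons j L ih =>
    have h1 : pdl (j :: L) f x = pd j (pdl L f) x := rfl
    have h2 : pdl L f = fun x => iteratedFDeriv ℝ L.length f x
      (fun i => Pi.single (L.get i) (1 : ℝ)) := funext ih
    have h3 : DifferentiableAt ℝ (iteratedFDeriv ℝ L.length f) x :=
      (hf.differentiable_iteratedFDeriv (by exact_mod_cast ENat.natCast_lt_top _)) x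
    rw [h1, h2]
    simp only [List.length_cons]
    rw [iteratedFDeriv_succ_apply_left]
    unfold pd
    rw [fderiv_continuousMultilinear_apply_const_apply h3]
    rfl

def canon {d : ℕ} (α : Fin d → ℕ) : List (Fin d) :=
  (List.finRange d).flatMap (fun j => List.replicate (α j) j)

lemma pdm_eq {d : ℕ} (α : Fin d → ℕ) (f : (Fin d → ℝ) → ℝ) : pdm α f = pdl (canon α) f := by
  unfold pdm canon
  induction (List.finRange d) with
  | nil => rfl
  | cons j L ih =>
    simp only [List.foldr_cons, List.flatMap_cons]
    rw [ih]
    unfold pdl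
    rw [List.foldr_append]
    generalize List.foldr pd f _ = h
    induction α j with
    | zero => rfl
    | succ n ihn => rw [Function.iterate_succ_apply', ihn]; rfl

lemma canon_length {d : ℕ} (α : Fin d → ℕ) : (canon α).length = ∑ j, α j := by
  unfold canon
  rw [List.length_flatMap]
  simp [List.sum_ofFn, ← List.ofFn_eq_map]

lemma canon_count {d : ℕ} (α : Fin d → ℕ) (j : Fin d) : (canon α).count j = α j := by
  unfold canon
  rw [List.count_flatMap]
  have : (List.count j ∘ fun j => List.replicate (α j) j) = fun i => if i = j then α i else 0 := by
    funext i
    simp [List.count_replicate]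
  rw [this, ← List.ofFn_eq_map, List.sum_ofFn]
  simp

lemma canon_perm {d : ℕ} (L : List (Fin d)) : L.Perm (canon fun j => L.count j) := by
  rw [List.perm_iff_count]
  intro a
  rw [canon_count]

lemma norm_pdm_le {d : ℕ} (α : Fin d → ℕ) {f : (Fin d → ℝ) → ℝ}
    (hf : ContDiff ℝ (⊤ : ℕ∞) f) (x : Fin d → ℝ) :
    |pdm α f x| ≤ ‖iteratedFDeriv ℝ (∑ j, α j) f x‖ := by
  rw [pdm_eq, pdl_apply _ hf, ← canon_length, ← Real.norm_eq_abs]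
  refine (ContinuousMultilinearMap.le_opNorm _ _).trans ?_
  refine mul_le_of_le_one_right (norm_nonneg _) ?_
  refine Finset.prod_le_one (fun _ _ => norm_nonneg _) fun i _ => ?_
  rw [Pi.norm_single]
  simp

lemma norm_le_sum_basis {d n : ℕ} (T : ContinuousMultilinearMap ℝ (fun _ : Fin n => Fin d → ℝ) ℝ) :
    ‖T‖ ≤ ∑ σ : Fin n → Fin d, ‖T (fun i => Pi.single (σ i) (1 : ℝ))‖ := by
  refine ContinuousMultilinearMap.opNorm_le_bound (Finset.sum_nonneg fun _ _ => norm_nonneg _) ?_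
  intro w
  have hw : w = fun i => ∑ j, w i j • (Pi.single j (1 : ℝ) : Fin d → ℝ) := by
    funext i
    exact pi_eq_sum_univ' (w i)
  conv_lhs => rw [hw]
  rw [T.map_sum]
  rw [Finset.sum_mul]
  refine (norm_sum_le _ _).trans (Finset.sum_le_sum fun σ _ => ?_)
  rw [T.map_smul_univ (fun i => w i (σ i)) (fun i => Pi.single (σ i) (1 : ℝ)), norm_smul, mul_comm]
  refine mul_le_mul_of_nonneg_left ?_ (norm_nonneg _)
  rw [norm_prod]
  exact Finset.prod_le_prod (fun _ _ => norm_nonneg _) fun i _ => norm_le_pi_norm _ _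

lemma norm_iter_le {d n : ℕ} {f : (Fin d → ℝ) → ℝ}
    (hf : ContDiff ℝ (⊤ : ℕ∞) f) (x : Fin d → ℝ) :
    ‖iteratedFDeriv ℝ n f x‖ ≤
      ∑ σ : Fin n → Fin d, |pdm (fun j => (List.ofFn σ).count j) f x| := by
  refine (norm_le_sum_basis _).trans (Finset.sum_le_sum fun σ _ => ?_)
  rw [pdm_eq, ← pdl_perm (canon_perm _) hf, pdl_apply _ hf, ← Real.norm_eq_abs]
  apply le_of_eq
  congr 1
  have : ∀ (L : List (Fin d)) (n : ℕ) (h : L.length = n) ,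
    iteratedFDeriv ℝ n f x (fun i => Pi.single (L.get (i.cast h.symm)) (1:ℝ)) =
     iteratedFDeriv ℝ L.length f x (fun i => Pi.single (L.get i) (1:ℝ)) := by
    intro L n h
    subst h
    rfl
  rw [← this (List.ofFn σ) n (by simp)]
  simp

lemma count_sum {d n : ℕ} (σ : Fin n → Fin d) : ∑ j, (List.ofFn σ).count j = n := by
  have := (canon_perm (List.ofFn σ)).length_eq
  rw [canon_length] at this
  simpa using this.symm

lemma norm_iter_iter {E F : Type*} [NormedAddCommGroup E] [NormedSpace ℝ E]
    [NormedAddCommGroup F] [NormedSpace ℝ F] {f : E → F} (i j : ℕ) (x : E) :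
    ‖iteratedFDeriv ℝ j (iteratedFDeriv ℝ i f) x‖ = ‖iteratedFDeriv ℝ (i + j) f x‖ := by
  induction i generalizing j with
  | zero =>
    rw [iteratedFDeriv_zero_eq_comp, LinearIsometryEquiv.norm_iteratedFDeriv_comp_left, zero_add]
  | succ i ih =>
    rw [iteratedFDeriv_succ_eq_comp_left]
    have := LinearIsometryEquiv.norm_iteratedFDeriv_comp_left (𝕜 := ℝ)
      (continuousMultilinearCurryLeftEquiv ℝ (fun _ : Fin (i + 1) => E) F).symm
      (fderiv ℝ (iteratedFDeriv ℝ i f)) x j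
    refine Eq.trans this ?_
    rw [norm_iteratedFDeriv_fderiv, ih, show i + 1 + j = i + (j + 1) by omega]


lemma lint_rpow_lt_top {c : ℝ} (hc : 0 < c) :
    ∫⁻ t in Set.Ioo (0 : ℝ) 1, ENNReal.ofReal (t ^ (c - 1)) < ⊤ := by
  have h : IntegrableOn (fun t : ℝ => t ^ (c - 1)) (Set.Ioo 0 1) :=
    (intervalIntegral.integrableOn_Ioo_rpow_iff one_pos).2 (by linarith)
  exact Integrable.lintegral_lt_top h

/-- Hölder with a power weight. -/
lemma holder_weight (k : ℕ) (p ε : ℝ) (hp : 1 < p) (hε : 0 < ε) :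
    ∃ C : ℝ≥0∞, C ≠ ⊤ ∧ ∀ H : ℝ → ℝ≥0∞, Measurable H →
      (∫⁻ t in Set.Ioo (0 : ℝ) 1, ENNReal.ofReal (t ^ ((k : ℝ) - 1)) * H t) ^ p ≤
        C * ∫⁻ t in Set.Ioo (0 : ℝ) 1, ENNReal.ofReal (t ^ (k * p - ε - 1)) * H t ^ p := by
  have hp0 : 0 < p := by linarith
  set q := p.conjExponent with hq
  have hpq : p.HolderConjugate q := Real.HolderConjugate.conjExponent hp
  have hq0 : 0 < q := hpq.symm.pos
  set a : ℝ := ((k : ℝ) - 1) - (k * p - ε - 1) / p with ha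
  have haq : a * q = (ε * q / p) - 1 := by
    have h1 : p⁻¹ + q⁻¹ = 1 := hpq.inv_add_inv_eq_one
    have h2 : q + p = p * q := by field_simp at h1; linarith
    rw [ha]; field_simp; nlinarith
  refine ⟨(∫⁻ t in Set.Ioo (0 : ℝ) 1, ENNReal.ofReal (t ^ (a * q))) ^ (p / q), ?_, ?_⟩
  · apply ENNReal.rpow_ne_top_of_nonneg (by positivity)
    rw [haq]
    exact (lint_rpow_lt_top (by positivity)).ne
  · intro H hH
    have h1 := ENNReal.lintegral_mul_le_Lp_mul_Lq (volume.restrict (Set.Ioo (0 : ℝ) 1)) hpq.symm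
      (f := fun t => ENNReal.ofReal (t ^ a))
      (g := fun t => ENNReal.ofReal (t ^ ((k * p - ε - 1) / p)) * H t)
      (by fun_prop) (by fun_prop)
    have e1 : ∫⁻ t in Set.Ioo (0 : ℝ) 1, ENNReal.ofReal (t ^ ((k : ℝ) - 1)) * H t =
        ∫⁻ t in Set.Ioo (0 : ℝ) 1, ((fun t => ENNReal.ofReal (t ^ a)) *
          (fun t => ENNReal.ofReal (t ^ ((k * p - ε - 1) / p)) * H t)) t := by
      refine setLIntegral_congr_fun measurableSet_Ioo fun t ht => ?_
      have ht0 : 0 < t := ht.1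
      simp only [Pi.mul_apply]
      rw [← mul_assoc, ← ENNReal.ofReal_mul (by positivity), ← Real.rpow_add ht0]
      congr 3
      rw [ha]; ring
    have e2 : ∫⁻ t in Set.Ioo (0 : ℝ) 1, (ENNReal.ofReal (t ^ a)) ^ q =
        ∫⁻ t in Set.Ioo (0 : ℝ) 1, ENNReal.ofReal (t ^ (a * q)) := by
      refine setLIntegral_congr_fun measurableSet_Ioo fun t ht => ?_
      have ht0 : 0 < t := ht.1
      rw [ENNReal.ofReal_rpow_of_pos (by positivity), Real.rpow_mul ht0.le]
    have e3 : ∫⁻ t in Set.Ioo (0 : ℝ) 1,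
        (ENNReal.ofReal (t ^ ((k * p - ε - 1) / p)) * H t) ^ p =
        ∫⁻ t in Set.Ioo (0 : ℝ) 1, ENNReal.ofReal (t ^ (k * p - ε - 1)) * H t ^ p := by
      refine setLIntegral_congr_fun measurableSet_Ioo fun t ht => ?_
      have ht0 : 0 < t := ht.1
      rw [ENNReal.mul_rpow_of_nonneg _ _ hp0.le, ENNReal.ofReal_rpow_of_pos (by positivity),
        ← Real.rpow_mul ht0.le, div_mul_cancel₀ _ hp0.ne']
    rw [e2, e3, ← e1] at h1
    calc _ ≤ _ := ENNReal.rpow_le_rpow h1 hp0.le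
      _ = _ := by
        rw [ENNReal.mul_rpow_of_nonneg _ _ hp0.le, ← ENNReal.rpow_mul, ← ENNReal.rpow_mul,
          one_div_mul_cancel hp0.ne', ENNReal.rpow_one]
        congr 2
        ring

lemma ibp_bound {F : Type*} [NormedAddCommGroup F] [NormedSpace ℝ F] [CompleteSpace F]
    {φ : ℝ → F} (hφ : ContDiff ℝ (⊤ : ℕ∞) φ) (h1 : ∀ j, iteratedDeriv j φ 1 = 0) (k : ℕ) :
    ‖φ 0‖ ≤ ‖∫ t in (0 : ℝ)..1, t ^ k • iteratedDeriv (k + 1) φ t‖ := by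
  have hc : ∀ j, Continuous (iteratedDeriv j φ) := fun j =>
    hφ.continuous_iteratedDeriv j (by exact_mod_cast le_top)
  have hd : ∀ j t, HasDerivAt (iteratedDeriv j φ) (iteratedDeriv (j + 1) φ t) t := by
    intro j t
    rw [iteratedDeriv_succ]
    exact (hφ.differentiable_iteratedDeriv j
      (by exact_mod_cast ENat.natCast_lt_top _) t).hasDerivAt
  induction k with
  | zero =>
    have := intervalIntegral.integral_eq_sub_of_hasDerivAt (a := 0) (b := 1)
      (fun t _ => hd 0 t) ((hc 1).intervalIntegrable 0 1)
    simp only [pow_zero, one_smul, zero_add] at this ⊢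
    rw [this, h1 0]
    simp
  | succ k ih =>
    refine ih.trans ?_
    have := intervalIntegral.integral_smul_deriv_eq_deriv_smul (a := (0 : ℝ)) (b := 1)
      (u := fun t => t ^ (k + 1)) (u' := fun t => ((k + 1 : ℕ) : ℝ) * t ^ k)
      (v := iteratedDeriv (k + 1) φ) (v' := iteratedDeriv (k + 1 + 1) φ)
      (fun t _ => by simpa using hasDerivAt_pow (k + 1) t) (fun t _ => hd (k + 1) t)
      ((by fun_prop : Continuous _).intervalIntegrable 0 1) ((hc _).intervalIntegrable 0 1)
    rw [this, h1]
    simp only [mul_smul]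
    rw [intervalIntegral.integral_smul]
    simp only [smul_zero, ne_eq, Nat.add_eq_zero_iff, one_ne_zero, and_false, not_false_eq_true,
      zero_pow, zero_smul, sub_self, zero_sub, norm_neg, norm_smul]
    refine le_mul_of_one_le_left (norm_nonneg _) ?_
    rw [Real.norm_of_nonneg (by positivity)]
    push_cast
    linarith [Nat.cast_nonneg (α := ℝ) k]

lemma exists_cutoff (k : ℕ) : ∃ η : ℝ → ℝ, ∃ M : ℝ, 0 ≤ M ∧ ContDiff ℝ (⊤ : ℕ∞) η ∧ η 0 = 1 ∧
    (∀ t, 3 / 4 < t → η t = 0) ∧ ∀ j ≤ k, ∀ t, ‖iteratedFDeriv ℝ j η t‖ ≤ M := by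
  let b : ContDiffBump (0 : ℝ) := ⟨1 / 4, 1 / 2, by norm_num, by norm_num⟩
  have hb : ContDiff ℝ (⊤ : ℕ∞) b := b.contDiff
  have hs : HasCompactSupport b := b.hasCompactSupport
  have h1 : ∀ j : ℕ, ∃ M, ∀ t, ‖iteratedFDeriv ℝ j b t‖ ≤ M := fun j =>
    (hs.iteratedFDeriv j).exists_bound_of_continuous
      (hb.continuous_iteratedFDeriv (by exact_mod_cast le_top))
  choose M hM using h1
  have hM0 : ∀ j, 0 ≤ M j := fun j => (norm_nonneg _).trans (hM j 0)
  refine ⟨b, ∑ j ∈ Finset.range (k + 1), M j, Finset.sum_nonneg fun j _ => hM0 j, hb, ?_, ?_, ?_⟩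
  · exact b.one_of_mem_closedBall (by simp [b])
  · intro t ht
    apply b.zero_of_le_dist
    simp only [b, Real.dist_eq, sub_zero]
    rw [abs_of_pos] <;> linarith
  · intro j hj t
    exact (hM j t).trans (Finset.single_le_sum (f := M) (fun j _ => hM0 j)
      (Finset.mem_range.2 (by omega)))

lemma iter_line {E F : Type*} [NormedAddCommGroup E] [NormedSpace ℝ E] [NormedAddCommGroup F]
    [NormedSpace ℝ F] {u : E → F} (hu : ContDiff ℝ (⊤ : ℕ∞) u) (x w : E) (j : ℕ) (t : ℝ) :
    ‖iteratedFDeriv ℝ j (fun s : ℝ => u (x + s • w)) t‖ ≤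
      ‖w‖ ^ j * ‖iteratedFDeriv ℝ j u (x + t • w)‖ := by
  have h1 : (fun s : ℝ => u (x + s • w)) =
    (fun y => u (x + y)) ∘ (ContinuousLinearMap.toSpanSingleton ℝ w) := by
    funext s; simp
  have h2 : ContDiff ℝ (⊤ : ℕ∞) (fun y => u (x + y)) := hu.comp (contDiff_const.add contDiff_id)
  rw [h1, ContinuousLinearMap.iteratedFDeriv_comp_right _ h2 t
    (i := j) (by exact_mod_cast le_top), iteratedFDeriv_comp_add_left]
  refine (ContinuousMultilinearMap.norm_compContinuousLinearMap_le _ _).trans ?_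
  simp [ContinuousLinearMap.norm_toSpanSingleton, mul_comm]

lemma pointwise_bound {E F : Type*} [NormedAddCommGroup E] [NormedSpace ℝ E] [NormedAddCommGroup F]
    [NormedSpace ℝ F] [CompleteSpace F] (k : ℕ) : ∃ C : ℝ, 0 ≤ C ∧ ∀ u : E → F,
    ContDiff ℝ (⊤ : ℕ∞) u → ∀ (x w : E) (R : ℝ), ‖w‖ ≤ R →
      ENNReal.ofReal ‖u x‖ ≤ ENNReal.ofReal C * ∫⁻ t in Set.Ioo (0 : ℝ) 1, ENNReal.ofReal (t ^ k) *
        ENNReal.ofReal (∑ j ∈ Finset.range (k + 2), R ^ j * ‖iteratedFDeriv ℝ j u (x + t • w)‖) := by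
  obtain ⟨η, M, hM, hη, hη0, hη1, hb⟩ := exists_cutoff (k + 1)
  set C : ℝ := ∑ j ∈ Finset.range (k + 2), ((k + 1).choose j : ℝ) * M with hC
  refine ⟨C, by positivity, ?_⟩
  intro u hu x w R hR
  have hl : ContDiff ℝ (⊤ : ℕ∞) (fun s : ℝ => u (x + s • w)) :=
    hu.comp (contDiff_const.add (contDiff_id.smul contDiff_const))
  set φ : ℝ → F := fun s => η s • u (x + s • w) with hφd
  have hφ : ContDiff ℝ (⊤ : ℕ∞) φ := hη.smul hl
  have hφ1 : ∀ j, iteratedDeriv j φ 1 = 0 := by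
    intro j
    have : φ =ᶠ[nhds 1] fun _ => 0 := by
      filter_upwards [lt_mem_nhds (show (3 / 4 : ℝ) < 1 by norm_num)] with s hs
      simp [hφd, hη1 s hs]
    rw [this.iteratedDeriv_eq]
    simp
  have hR0 : 0 ≤ R := (norm_nonneg _).trans hR
  set G : ℝ → ℝ := fun t => ∑ j ∈ Finset.range (k + 2), R ^ j * ‖iteratedFDeriv ℝ j u (x + t • w)‖
    with hG
  have hGc : Continuous G := by
    refine continuous_finsetSum _ fun j _ => continuous_const.mul (Continuous.norm ?_)
    have := hu.continuous_iteratedFDeriv (m := j) (by exact_mod_cast le_top)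
    exact this.comp (by fun_prop)
  have hG0 : ∀ t, 0 ≤ G t := fun t => by positivity
  have hpt : ∀ t, ‖iteratedDeriv (k + 1) φ t‖ ≤ C * G t := by
    intro t
    rw [← norm_iteratedFDeriv_eq_norm_iteratedDeriv]
    refine (norm_iteratedFDeriv_smul_le hη hl t (n := k + 1) (by exact_mod_cast le_top)).trans ?_
    rw [hC, Finset.sum_mul]
    refine Finset.sum_le_sum fun j hj => ?_
    have hj' : j ≤ k + 1 := by have := Finset.mem_range.1 hj; omega
    have h1 : ‖iteratedFDeriv ℝ (k + 1 - j) (fun s : ℝ => u (x + s • w)) t‖ ≤ G t := by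
      refine (iter_line hu x w _ t).trans ?_
      refine le_trans ?_ (Finset.single_le_sum
        (f := fun j => R ^ j * ‖iteratedFDeriv ℝ j u (x + t • w)‖)
        (fun j _ => by positivity) (Finset.mem_range.2 (show k + 1 - j < k + 2 by omega)))
      gcongr
    have h2 := hb j hj' t
    gcongr
  have hmain : ‖u x‖ ≤ ∫ t in (0 : ℝ)..1, C * (t ^ k * G t) := by
    have h0 : φ 0 = u x := by simp [hφd, hη0]
    rw [← h0]
    refine (ibp_bound hφ hφ1 k).trans ?_
    refine intervalIntegral.norm_integral_le_of_norm_le zero_le_one ?_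
      ((by fun_prop : Continuous _).intervalIntegrable 0 1)
    refine Filter.Eventually.of_forall fun t ht => ?_
    have ht0 : 0 ≤ t := ht.1.le
    rw [norm_smul, norm_pow, Real.norm_of_nonneg ht0]
    have := hpt t
    calc _ ≤ t ^ k * (C * G t) := by gcongr
      _ = _ := by ring
  refine (ENNReal.ofReal_le_ofReal hmain).trans ?_
  rw [intervalIntegral.integral_const_mul, ENNReal.ofReal_mul (by positivity)]
  gcongr
  rw [intervalIntegral.integral_of_le zero_le_one, integral_Ioc_eq_integral_Ioo,
    ofReal_integral_eq_lintegral_ofReal]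
  · refine le_of_eq (setLIntegral_congr_fun measurableSet_Ioo fun t ht => ?_)
    exact ENNReal.ofReal_mul (pow_nonneg ht.1.le _)
  · exact ((by fun_prop : Continuous _).integrableOn_Icc (a := (0 : ℝ)) (b := 1)).mono_set
      Set.Ioo_subset_Icc_self
  · refine (ae_restrict_iff' measurableSet_Ioo).2 (Filter.Eventually.of_forall fun t ht => ?_)
    exact mul_nonneg (pow_nonneg ht.1.le _) (hG0 t)


section
variable {d : ℕ}

lemma one_le_jap (x : Fin d → ℝ) : 1 ≤ jap x := by
  unfold jap
  rw [Real.one_le_sqrt]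
  have : 0 ≤ ∑ i, x i ^ 2 := by positivity
  linarith

lemma jap_pos (x : Fin d → ℝ) : 0 < jap x := lt_of_lt_of_le one_pos (one_le_jap x)

lemma jap_cont : Continuous (jap (d := d)) := by
  unfold jap
  fun_prop

lemma jap_lip (x y : Fin d → ℝ) : jap x ≤ jap y + d * ‖x - y‖ := by
  have he : ∑ i, |x i - y i| ≤ d * ‖x - y‖ := by
    have : ∀ i ∈ Finset.univ, |x i - y i| ≤ ‖x - y‖ := fun i _ => norm_le_pi_norm (x - y) i
    simpa using Finset.sum_le_card_nsmul _ _ _ this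
  refine le_trans ?_ (add_le_add_right he _)
  set e := ∑ i, |x i - y i| with hedef
  have he0 : 0 ≤ e := by positivity
  have hj := jap_pos y
  have hsq : jap y ^ 2 = 1 + ∑ i, y i ^ 2 := by
    unfold jap
    rw [Real.sq_sqrt (by positivity)]
  have hyi : ∀ i, |y i| ≤ jap y := by
    intro i
    unfold jap
    apply Real.abs_le_sqrt
    have := Finset.single_le_sum (f := fun i => y i ^ 2) (fun i _ => sq_nonneg _)
      (Finset.mem_univ i)
    linarith
  have h2 : ∑ i, |x i - y i| ^ 2 ≤ e ^ 2 :=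
    Finset.sum_sq_le_sq_sum_of_nonneg (fun i _ => abs_nonneg _)
  have h3 : ∑ i, x i ^ 2 ≤ ∑ i, (y i ^ 2 + 2 * jap y * |x i - y i| + |x i - y i| ^ 2) := by
    refine Finset.sum_le_sum fun i _ => ?_
    have h4 : y i * (x i - y i) ≤ jap y * |x i - y i| := by
      refine (le_abs_self _).trans ?_
      rw [abs_mul]
      exact mul_le_mul_of_nonneg_right (hyi i) (abs_nonneg _)
    rw [sq_abs]
    nlinarith
  rw [Finset.sum_add_distrib, Finset.sum_add_distrib, ← Finset.mul_sum] at h3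
  conv_lhs => unfold jap
  rw [Real.sqrt_le_left (by positivity)]
  nlinarith

noncomputable def rad (x : Fin d → ℝ) : ℝ := (1 / (2 * d)) * jap x

lemma rad_pos (hd : 1 ≤ d) (x : Fin d → ℝ) : 0 < rad x := by
  unfold rad
  have := jap_pos x
  have : (0 : ℝ) < d := by exact_mod_cast hd
  positivity

lemma rad_cont : Continuous (rad (d := d)) := by
  unfold rad
  exact continuous_const.mul jap_cont

lemma jap_comp (hd : 1 ≤ d) {x y : Fin d → ℝ} (h : ‖y - x‖ ≤ rad x) :
    jap x ≤ 2 * jap y ∧ jap y ≤ 2 * jap x := by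
  have hd' : (0 : ℝ) < d := by exact_mod_cast hd
  have h1 : d * ‖y - x‖ ≤ jap x / 2 := by
    calc d * ‖y - x‖ ≤ d * rad x := by gcongr
      _ = _ := by unfold rad; field_simp
  have h2 := jap_lip x y
  have h3 := jap_lip y x
  rw [norm_sub_rev] at h2
  have := jap_pos x
  constructor <;> linarith

lemma rad_comp (hd : 1 ≤ d) {x y : Fin d → ℝ} (h : ‖y - x‖ ≤ rad x) :
    rad x ≤ 2 * rad y ∧ rad y ≤ 2 * rad x := by
  have hd' : (0 : ℝ) < d := by exact_mod_cast hd
  obtain ⟨h1, h2⟩ := jap_comp hd h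
  unfold rad
  have : (0 : ℝ) < 1 / (2 * d) := by positivity
  constructor <;> nlinarith

lemma jap_rpow_comp (hd : 1 ≤ d) {x y : Fin d → ℝ} (h : ‖y - x‖ ≤ rad x) (s : ℝ) :
    jap x ^ s ≤ 2 ^ |s| * jap y ^ s := by
  obtain ⟨h1, h2⟩ := jap_comp hd h
  have hx := jap_pos x
  have hy := jap_pos y
  rcases le_total 0 s with hs | hs
  · rw [abs_of_nonneg hs, ← Real.mul_rpow (by norm_num) hy.le]
    exact Real.rpow_le_rpow hx.le h1 hs
  · rw [abs_of_nonpos hs, Real.rpow_neg (by norm_num), ← Real.inv_rpow (by norm_num),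
      ← Real.mul_rpow (by norm_num) hy.le]
    exact Real.rpow_le_rpow_of_nonpos (by positivity) (by linarith) hs

/-- averaging kernel -/
@[irreducible] noncomputable def ker (t : ℝ) (x y : Fin d → ℝ) : ℝ≥0∞ :=
  if ‖y - x‖ < t * rad x then ENNReal.ofReal (((t * rad x) ^ d)⁻¹) else 0

lemma ker_meas : Measurable (fun q : (Fin d → ℝ) × (ℝ × (Fin d → ℝ)) => ker q.2.1 q.1 q.2.2) := by
  unfold ker
  have := (rad_cont (d := d)).measurable
  refine Measurable.ite (measurableSet_lt ?_ ?_) ?_ ?_ <;> fun_prop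

lemma ker_meas₁ (x : Fin d → ℝ) : Measurable (fun q : ℝ × (Fin d → ℝ) => ker q.1 x q.2) :=
  (ker_meas (d := d)).comp (measurable_prodMk_left (x := x))

lemma ker_meas₂ (t : ℝ) (x : Fin d → ℝ) : Measurable (fun y : Fin d → ℝ => ker t x y) :=
  (ker_meas₁ x).comp (measurable_prodMk_left (x := t))

lemma ker_meas₃ (t : ℝ) (y : Fin d → ℝ) : Measurable (fun x : Fin d → ℝ => ker t x y) :=
  ker_meas.comp (measurable_prodMk_right (y := (t, y)))

lemma wt_meas (a : ℝ) : Measurable (fun t : ℝ => ENNReal.ofReal (t ^ a)) := by fun_prop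

lemma avg_eq {ρ : ℝ} (hρ : 0 < ρ) (x : Fin d → ℝ) {F : (Fin d → ℝ) → ℝ≥0∞} (hF : Measurable F) :
    ∫⁻ v in Metric.ball (0 : Fin d → ℝ) 1, F (x + ρ • v) =
      ENNReal.ofReal ((ρ ^ d)⁻¹) * ∫⁻ y in Metric.ball x ρ, F y := by
  rw [← lintegral_indicator Metric.isOpen_ball.measurableSet,
    ← lintegral_indicator Metric.isOpen_ball.measurableSet]
  have h1 : ∀ v, (Metric.ball (0 : Fin d → ℝ) 1).indicator (fun v => F (x + ρ • v)) v =
      (Metric.ball x ρ).indicator F (x + ρ • v) := by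
    intro v
    have : v ∈ Metric.ball (0 : Fin d → ℝ) 1 ↔ x + ρ • v ∈ Metric.ball x ρ := by
      simp [norm_smul, abs_of_pos hρ, hρ]
    by_cases hv : v ∈ Metric.ball (0 : Fin d → ℝ) 1
    · rw [Set.indicator_of_mem hv, Set.indicator_of_mem (this.1 hv)]
    · rw [Set.indicator_of_notMem hv, Set.indicator_of_notMem (fun h => hv (this.2 h))]
  simp_rw [h1]
  have hI : Measurable ((Metric.ball x ρ).indicator F) :=
    hF.indicator Metric.isOpen_ball.measurableSet
  have h2 := Measure.map_addHaar_smul (volume : Measure (Fin d → ℝ)) hρ.ne'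
  have h3 : ∫⁻ v, (Metric.ball x ρ).indicator F (x + ρ • v) =
      ∫⁻ v, (Metric.ball x ρ).indicator F (x + v) ∂(Measure.map (ρ • ·) volume) := by
    rw [lintegral_map (by fun_prop) (by fun_prop)]
  rw [h3, h2, lintegral_smul_measure, lintegral_add_left_eq_self]
  simp [abs_of_pos hρ]

lemma avg_eq_ker (hd : 1 ≤ d) {t : ℝ} (ht : 0 < t) (x : Fin d → ℝ) {F : (Fin d → ℝ) → ℝ≥0∞}
    (hF : Measurable F) :
    ∫⁻ v in Metric.ball (0 : Fin d → ℝ) 1, F (x + (t * rad x) • v) =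
      ∫⁻ y, ker t x y * F y := by
  have hr := rad_pos hd x
  rw [avg_eq (by positivity) x hF, ← lintegral_const_mul _ hF,
    ← lintegral_indicator Metric.isOpen_ball.measurableSet]
  congr 1
  funext y
  unfold ker
  by_cases h : ‖y - x‖ < t * rad x
  · rw [if_pos h, Set.indicator_of_mem (by simpa [dist_eq_norm] using h)]
  · rw [if_neg h, Set.indicator_of_notMem (by simpa [dist_eq_norm] using h), zero_mul]

lemma ker_int (hd : 1 ≤ d) {t : ℝ} (ht : 0 < t) (ht1 : t < 1) (y : Fin d → ℝ) :
    ∫⁻ x, (if ‖y - x‖ < t * rad x then ENNReal.ofReal ((rad x ^ d)⁻¹) else 0) ≤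
      ENNReal.ofReal (8 ^ d * t ^ d) := by
  have hy := rad_pos hd y
  have h1 : ∀ x, (if ‖y - x‖ < t * rad x then ENNReal.ofReal ((rad x ^ d)⁻¹) else 0) ≤
      (Metric.ball y (2 * t * rad y)).indicator
        (fun _ => ENNReal.ofReal (2 ^ d * (rad y ^ d)⁻¹)) x := by
    intro x
    split_ifs with h
    · have hx := rad_pos hd x
      have hle : ‖y - x‖ ≤ rad x := h.le.trans (mul_le_of_le_one_left hx.le ht1.le)
      obtain ⟨h2, h3⟩ := rad_comp hd hle
      rw [Set.indicator_of_mem]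
      · apply ENNReal.ofReal_le_ofReal
        rw [inv_le_iff_one_le_mul₀ (by positivity), mul_right_comm, ← div_eq_mul_inv,
          one_le_div (by positivity), ← mul_pow]
        gcongr
      · rw [Metric.mem_ball, dist_eq_norm, norm_sub_rev]
        nlinarith
    · exact bot_le
  refine (lintegral_mono h1).trans ?_
  rw [lintegral_indicator Metric.isOpen_ball.measurableSet, lintegral_const,
    Measure.restrict_apply_univ, Real.volume_pi_ball _ (by positivity),
    ← ENNReal.ofReal_mul (by positivity)]
  apply ENNReal.ofReal_le_ofReal
  rw [Fintype.card_fin]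
  apply le_of_eq
  rw [show (8 : ℝ) = 2 * 2 * 2 by norm_num]
  simp only [mul_pow]
  field_simp

lemma min_pow_le {t s θ₁ θ₂ : ℝ} (ht : 0 < t) (hs : 0 < s) (h1 : 0 ≤ θ₁) (h2 : 0 ≤ θ₂)
    (h : θ₁ + θ₂ = d) : min (t ^ d) (s ^ d) ≤ t ^ θ₁ * s ^ θ₂ := by
  rcases le_total t s with hts | hts
  · refine (min_le_left _ _).trans ?_
    rw [← Real.rpow_natCast, ← h, Real.rpow_add ht]
    gcongr
  · refine (min_le_right _ _).trans ?_
    rw [← Real.rpow_natCast, ← h, Real.rpow_add hs]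
    gcongr

lemma ker_ker (hd : 1 ≤ d) {t s θ₁ θ₂ : ℝ} (ht : 0 < t) (ht1 : t < 1) (hs : 0 < s) (hs1 : s < 1)
    (h1 : 0 ≤ θ₁) (h2 : 0 ≤ θ₂) (h : θ₁ + θ₂ = d) (y z : Fin d → ℝ) :
    ∫⁻ x, ENNReal.ofReal (jap x ^ d) * (ker t x y * ker s x z) ≤
      ENNReal.ofReal ((2 * d) ^ d * 8 ^ d) *
        (ENNReal.ofReal (t ^ (θ₁ - d)) * ENNReal.ofReal (s ^ (θ₂ - d))) := by
  have hd' : (0 : ℝ) < d := by exact_mod_cast hd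
  have hpt : ∀ x, ENNReal.ofReal (jap x ^ d) * (ker t x y * ker s x z) ≤
     ENNReal.ofReal ((2 * d) ^ d * ((t ^ d)⁻¹ * (s ^ d)⁻¹)) *
      min (if ‖y - x‖ < t * rad x then ENNReal.ofReal ((rad x ^ d)⁻¹) else 0)
        (if ‖z - x‖ < s * rad x then ENNReal.ofReal ((rad x ^ d)⁻¹) else 0) := by
    intro x
    have hx := rad_pos hd x
    unfold ker
    split_ifs
    · rw [min_self, ← ENNReal.ofReal_mul (by positivity), ← ENNReal.ofReal_mul (by
        have := jap_pos x; positivity), ← ENNReal.ofReal_mul (by positivity)]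
      apply ENNReal.ofReal_le_ofReal
      have : jap x = 2 * d * rad x := by unfold rad; field_simp
      rw [this]
      simp only [mul_pow]
      apply le_of_eq
      field_simp
    all_goals simp
  have hm : ∀ a, a = t ∨ a = s → ∀ w : Fin d → ℝ, Measurable fun x : Fin d → ℝ =>
    (if ‖w - x‖ < a * rad x then ENNReal.ofReal ((rad x ^ d)⁻¹) else 0) := by
    intro a _ w
    have := (rad_cont (d := d)).measurable
    refine Measurable.ite (measurableSet_lt ?_ ?_) ?_ ?_ <;> fun_prop
  refine (lintegral_mono hpt).trans ?_
  rw [lintegral_const_mul _ ((hm t (Or.inl rfl) y).min (hm s (Or.inr rfl) z))]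
  have hmin : ∫⁻ x, min (if ‖y - x‖ < t * rad x then ENNReal.ofReal ((rad x ^ d)⁻¹) else 0)
        (if ‖z - x‖ < s * rad x then ENNReal.ofReal ((rad x ^ d)⁻¹) else 0) ≤
        ENNReal.ofReal (8 ^ d * (t ^ θ₁ * s ^ θ₂)) := by
    refine (le_min ((lintegral_mono fun x => min_le_left _ _).trans (ker_int hd ht ht1 y))
      ((lintegral_mono fun x => min_le_right _ _).trans (ker_int hd hs hs1 z))).trans ?_
    rw [← ENNReal.ofReal_mono.map_min]
    apply ENNReal.ofReal_le_ofReal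
    rw [← mul_min_of_nonneg _ _ (by positivity)]
    gcongr
    exact min_pow_le ht hs h1 h2 h
  refine (mul_le_mul_right hmin _).trans ?_
  rw [← ENNReal.ofReal_mul (by positivity), ← ENNReal.ofReal_mul (by positivity),
    ← ENNReal.ofReal_mul (by positivity), Real.rpow_sub ht, Real.rpow_sub hs,
    Real.rpow_natCast, Real.rpow_natCast]
  apply ENNReal.ofReal_le_ofReal
  apply le_of_eq
  field_simp

/-- the superposition of averages -/
noncomputable def Avg (a : ℝ) (F : (Fin d → ℝ) → ℝ≥0∞) (x : Fin d → ℝ) : ℝ≥0∞ :=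
  ∫⁻ t in Set.Ioo (0 : ℝ) 1, ENNReal.ofReal (t ^ (a - 1)) * ∫⁻ y, ker t x y * F y

lemma tonelli3 {X A B : Type*} [MeasurableSpace X] [MeasurableSpace A] [MeasurableSpace B]
    {μ : Measure X} {ν : Measure A} {τ : Measure B} [SFinite μ] [SFinite ν] [SFinite τ]
    {J : X → ℝ≥0∞} {k₁ : X × A → ℝ≥0∞} {k₂ : X × B → ℝ≥0∞} (hJ : Measurable J)
    (h1 : Measurable k₁) (h2 : Measurable k₂) :
    ∫⁻ x, J x * ((∫⁻ a, k₁ (x, a) ∂ν) * ∫⁻ b, k₂ (x, b) ∂τ) ∂μ =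
      ∫⁻ a, ∫⁻ b, ∫⁻ x, J x * (k₁ (x, a) * k₂ (x, b)) ∂μ ∂τ ∂ν := by
  have e1 : ∀ x, J x * ((∫⁻ a, k₁ (x, a) ∂ν) * ∫⁻ b, k₂ (x, b) ∂τ) =
      ∫⁻ a, ∫⁻ b, J x * (k₁ (x, a) * k₂ (x, b)) ∂τ ∂ν := by
    intro x
    have hb : Measurable fun b => k₂ (x, b) := by fun_prop
    have ha : Measurable fun a => k₁ (x, a) := by fun_prop
    rw [← lintegral_mul_const _ ha, ← lintegral_const_mul _ (by fun_prop)]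
    congr 1
    funext a
    rw [lintegral_const_mul _ (by fun_prop), lintegral_const_mul _ hb]
  simp_rw [e1]
  rw [lintegral_lintegral_swap]
  · congr 1
    funext a
    rw [lintegral_lintegral_swap]
    exact Measurable.aemeasurable (by fun_prop)
  · apply Measurable.aemeasurable
    exact Measurable.lintegral_prod_right' (f := fun q : (X × A) × B =>
      J q.1.1 * (k₁ q.1 * k₂ (q.1.1, q.2))) (by fun_prop)

lemma Avg_eq (a : ℝ) {F : (Fin d → ℝ) → ℝ≥0∞} (hF : Measurable F) (x : Fin d → ℝ) :
    Avg a F x = ∫⁻ q : ℝ × (Fin d → ℝ), ENNReal.ofReal (q.1 ^ (a - 1)) * (ker q.1 x q.2 * F q.2)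
      ∂((volume.restrict (Set.Ioo (0 : ℝ) 1)).prod volume) := by
  have hm : Measurable fun q : ℝ × (Fin d → ℝ) =>
      ENNReal.ofReal (q.1 ^ (a - 1)) * (ker q.1 x q.2 * F q.2) :=
    ((wt_meas _).comp measurable_fst).mul ((ker_meas₁ x).mul (hF.comp measurable_snd))
  rw [lintegral_prod _ hm.aemeasurable]
  unfold Avg
  congr 1
  funext t
  exact (lintegral_const_mul _ ((ker_meas₂ t x).mul hF)).symm

lemma Avg_bilin (hd : 1 ≤ d) {a b : ℝ} (ha : 0 < a) (hb : 0 < b) (hab : d < a + b) :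
    ∃ C : ℝ≥0∞, C ≠ ⊤ ∧ ∀ F G : (Fin d → ℝ) → ℝ≥0∞, Measurable F → Measurable G →
      ∫⁻ x, ENNReal.ofReal (jap x ^ d) * (Avg a F x * Avg b G x) ≤
        C * ((∫⁻ x, F x) * ∫⁻ x, G x) := by
  have hd' : (0 : ℝ) < d := by exact_mod_cast hd
  set θ₁ : ℝ := d * b / (a + b) with hθ₁
  set θ₂ : ℝ := d * a / (a + b) with hθ₂
  have hθ : θ₁ + θ₂ = d := by rw [hθ₁, hθ₂]; field_simp; ring
  have hr : d / (a + b) < 1 := by rw [div_lt_one (by positivity)]; exact hab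
  have h1 : 0 < a + θ₁ - d := by
    have : a + θ₁ - d = a * (1 - d / (a + b)) := by rw [hθ₁]; field_simp; ring
    rw [this]; exact mul_pos ha (by linarith)
  have h2 : 0 < b + θ₂ - d := by
    have : b + θ₂ - d = b * (1 - d / (a + b)) := by rw [hθ₂]; field_simp; ring
    rw [this]; exact mul_pos hb (by linarith)
  set I₁ := ∫⁻ t in Set.Ioo (0 : ℝ) 1, ENNReal.ofReal (t ^ ((a + θ₁ - d) - 1)) with hI₁
  set I₂ := ∫⁻ t in Set.Ioo (0 : ℝ) 1, ENNReal.ofReal (t ^ ((b + θ₂ - d) - 1)) with hI₂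
  refine ⟨ENNReal.ofReal ((2 * d) ^ d * 8 ^ d) * (I₁ * I₂), ?_, ?_⟩
  · exact ENNReal.mul_ne_top ENNReal.ofReal_ne_top (ENNReal.mul_ne_top
      (lint_rpow_lt_top h1).ne (lint_rpow_lt_top h2).ne)
  intro F G hF hG
  have hj : Measurable fun x : Fin d → ℝ => ENNReal.ofReal (jap x ^ d) := by
    have := (jap_cont (d := d)).measurable
    fun_prop
  simp_rw [Avg_eq a hF, Avg_eq b hG]
  rw [tonelli3 (k₁ := fun q : (Fin d → ℝ) × (ℝ × (Fin d → ℝ)) =>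
      ENNReal.ofReal (q.2.1 ^ (a - 1)) * (ker q.2.1 q.1 q.2.2 * F q.2.2))
    (k₂ := fun q : (Fin d → ℝ) × (ℝ × (Fin d → ℝ)) =>
      ENNReal.ofReal (q.2.1 ^ (b - 1)) * (ker q.2.1 q.1 q.2.2 * G q.2.2)) hj
      (((wt_meas _).comp (measurable_fst.comp measurable_snd)).mul
        (ker_meas.mul (hF.comp (measurable_snd.comp measurable_snd))))
      (((wt_meas _).comp (measurable_fst.comp measurable_snd)).mul
        (ker_meas.mul (hG.comp (measurable_snd.comp measurable_snd))))]
  set ν := (volume.restrict (Set.Ioo (0 : ℝ) 1)).prod (volume : Measure (Fin d → ℝ)) with hν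
  have hae : ∀ᵐ q ∂ν, q.1 ∈ Set.Ioo (0 : ℝ) 1 :=
    Measure.quasiMeasurePreserving_fst.ae (ae_restrict_mem measurableSet_Ioo)
  set f₁ : ℝ × (Fin d → ℝ) → ℝ≥0∞ := fun q => ENNReal.ofReal (q.1 ^ ((a + θ₁ - d) - 1)) * F q.2
  set f₂ : ℝ × (Fin d → ℝ) → ℝ≥0∞ := fun q => ENNReal.ofReal (q.1 ^ ((b + θ₂ - d) - 1)) * G q.2
  have hf₁ : Measurable f₁ := ((wt_meas _).comp measurable_fst).mul (hF.comp measurable_snd)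
  have hf₂ : Measurable f₂ := ((wt_meas _).comp measurable_fst).mul (hG.comp measurable_snd)
  set K := ENNReal.ofReal ((2 * d) ^ d * 8 ^ d)
  have hbound : ∀ᵐ q ∂ν, ∀ᵐ q' ∂ν, ∫⁻ x, ENNReal.ofReal (jap x ^ d) *
      ((ENNReal.ofReal (q.1 ^ (a - 1)) * (ker q.1 x q.2 * F q.2)) *
        (ENNReal.ofReal (q'.1 ^ (b - 1)) * (ker q'.1 x q'.2 * G q'.2))) ≤ K * (f₁ q * f₂ q') := by
    filter_upwards [hae] with q hq
    filter_upwards [hae] with q' hq'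
    have e : ∀ x, ENNReal.ofReal (jap x ^ d) *
      ((ENNReal.ofReal (q.1 ^ (a - 1)) * (ker q.1 x q.2 * F q.2)) *
        (ENNReal.ofReal (q'.1 ^ (b - 1)) * (ker q'.1 x q'.2 * G q'.2))) =
        (ENNReal.ofReal (q.1 ^ (a - 1)) * F q.2 * (ENNReal.ofReal (q'.1 ^ (b - 1)) * G q'.2)) *
        (ENNReal.ofReal (jap x ^ d) * (ker q.1 x q.2 * ker q'.1 x q'.2)) := by
      intro x; ring
    simp_rw [e]
    have hm : Measurable fun x =>
        ENNReal.ofReal (jap x ^ d) * (ker q.1 x q.2 * ker q'.1 x q'.2) :=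
      hj.mul ((ker_meas₃ q.1 q.2).mul (ker_meas₃ q'.1 q'.2))
    rw [lintegral_const_mul _ hm]
    refine (mul_le_mul_right (ker_ker hd hq.1 hq.2 hq'.1 hq'.2 (by positivity) (by positivity) hθ
      q.2 q'.2) _).trans (le_of_eq ?_)
    have e1 : ENNReal.ofReal (q.1 ^ ((a + θ₁ - d) - 1)) =
        ENNReal.ofReal (q.1 ^ (a - 1)) * ENNReal.ofReal (q.1 ^ (θ₁ - d)) := by
      have := hq.1
      rw [← ENNReal.ofReal_mul (by positivity), ← Real.rpow_add hq.1]
      congr 2; ring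
    have e2 : ENNReal.ofReal (q'.1 ^ ((b + θ₂ - d) - 1)) =
        ENNReal.ofReal (q'.1 ^ (b - 1)) * ENNReal.ofReal (q'.1 ^ (θ₂ - d)) := by
      have := hq'.1
      rw [← ENNReal.ofReal_mul (by positivity), ← Real.rpow_add hq'.1]
      congr 2; ring
    simp only [f₁, f₂, K]
    rw [e1, e2]
    ring
  calc _ ≤ ∫⁻ q, ∫⁻ q', K * (f₁ q * f₂ q') ∂ν ∂ν := by
        refine lintegral_mono_ae ?_
        filter_upwards [hbound] with q hq
        exact lintegral_mono_ae hq
    _ = K * ((∫⁻ q, f₁ q ∂ν) * ∫⁻ q, f₂ q ∂ν) := by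
        rw [← lintegral_mul_const _ hf₁, ← lintegral_const_mul _ (hf₁.mul_const _)]
        congr 1
        funext q
        rw [lintegral_const_mul _ (hf₂.const_mul _), lintegral_const_mul _ hf₂]
    _ = _ := by
        rw [lintegral_prod_mul (f := fun t => ENNReal.ofReal (t ^ ((a + θ₁ - d) - 1))) (g := F)
          (wt_meas _).aemeasurable hF.aemeasurable,
          lintegral_prod_mul (f := fun t => ENNReal.ofReal (t ^ ((b + θ₂ - d) - 1))) (g := G)
          (wt_meas _).aemeasurable hG.aemeasurable]
        ring

lemma Avg_sup (hd : 1 ≤ d) {b : ℝ} (hb : d < b) :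
    ∃ C : ℝ≥0∞, C ≠ ⊤ ∧ ∀ G : (Fin d → ℝ) → ℝ≥0∞, Measurable G → ∀ x,
      ENNReal.ofReal (jap x ^ d) * Avg b G x ≤ C * ∫⁻ x, G x := by
  have hd' : (0 : ℝ) < d := by exact_mod_cast hd
  set I := ∫⁻ t in Set.Ioo (0 : ℝ) 1, ENNReal.ofReal (t ^ ((b - d) - 1)) with hI
  refine ⟨ENNReal.ofReal ((2 * d) ^ d) * I, ENNReal.mul_ne_top ENNReal.ofReal_ne_top
    (lint_rpow_lt_top (by linarith)).ne, ?_⟩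
  intro G hG x
  have hx := rad_pos hd x
  have hjx := jap_pos x
  have h1 : ∀ t ∈ Set.Ioo (0 : ℝ) 1, ENNReal.ofReal (t ^ (b - 1)) * ∫⁻ y, ker t x y * G y ≤
      ENNReal.ofReal (t ^ ((b - d) - 1)) * (ENNReal.ofReal ((rad x ^ d)⁻¹) * ∫⁻ y, G y) := by
    intro t ht
    have ht0 := ht.1
    have h2 : ∫⁻ y, ker t x y * G y ≤ ENNReal.ofReal (((t * rad x) ^ d)⁻¹) * ∫⁻ y, G y := by
      rw [← lintegral_const_mul _ hG]
      refine lintegral_mono fun y => ?_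
      refine mul_le_mul_left ?_ _
      unfold ker
      split_ifs
      · exact le_rfl
      · exact bot_le
    refine (mul_le_mul_right h2 _).trans (le_of_eq ?_)
    rw [← mul_assoc, ← mul_assoc, ← ENNReal.ofReal_mul (by positivity),
      ← ENNReal.ofReal_mul (by positivity)]
    congr 2
    rw [show b - d - 1 = (b - 1) - d by ring, Real.rpow_sub ht0 (b - 1), Real.rpow_natCast]
    simp only [mul_pow]
    field_simp
  unfold Avg
  have h3 := setLIntegral_mono' (μ := volume) measurableSet_Ioo h1
  rw [lintegral_mul_const _ (by fun_prop)] at h3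
  refine (mul_le_mul_right h3 _).trans (le_of_eq ?_)
  have : ENNReal.ofReal ((2 * d) ^ d) = ENNReal.ofReal (jap x ^ d) *
      ENNReal.ofReal ((rad x ^ d)⁻¹) := by
    rw [← ENNReal.ofReal_mul (by positivity)]
    congr 1
    have : jap x = 2 * d * rad x := by unfold rad; field_simp
    rw [this]
    simp only [mul_pow]
    field_simp
  rw [this]
  ring

end


section
variable {d : ℕ}

noncomputable def wt (p δ : ℝ) (i : ℕ) (f : (Fin d → ℝ) → ℝ) (x : Fin d → ℝ) : ℝ≥0∞ :=
  ENNReal.ofReal (jap x ^ ((δ + i) * p)) * ENNReal.ofReal ‖iteratedFDeriv ℝ i f x‖ ^ p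

noncomputable def Phi (m : ℕ) (p δ : ℝ) (f : (Fin d → ℝ) → ℝ) (x : Fin d → ℝ) : ℝ≥0∞ :=
  ∑ i ∈ Finset.range (m + 1), wt p δ i f x

lemma wt_meas' (p δ : ℝ) (i : ℕ) {f : (Fin d → ℝ) → ℝ} (hf : ContDiff ℝ (⊤ : ℕ∞) f) :
    Measurable (wt p δ i f) := by
  unfold wt
  have h1 := (jap_cont (d := d)).measurable
  have h2 : Measurable fun x => ‖iteratedFDeriv ℝ i f x‖ :=
    (hf.continuous_iteratedFDeriv (m := i) (by exact_mod_cast le_top)).norm.measurable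
  fun_prop

lemma Phi_meas (m : ℕ) (p δ : ℝ) {f : (Fin d → ℝ) → ℝ} (hf : ContDiff ℝ (⊤ : ℕ∞) f) :
    Measurable (Phi m p δ f) := by
  unfold Phi
  exact Finset.measurable_fun_sum _ fun i _ => wt_meas' p δ i hf

lemma wt_le_Phi {m i : ℕ} (hi : i ≤ m) (p δ : ℝ) (f : (Fin d → ℝ) → ℝ) (x : Fin d → ℝ) :
    wt p δ i f x ≤ Phi m p δ f x :=
  Finset.single_le_sum (f := fun i => wt p δ i f x) (fun _ _ => bot_le)
    (Finset.mem_range.2 (by omega))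

lemma weight_shift (hd : 1 ≤ d) {m i j : ℕ} (hij : i + j ≤ m) {p : ℝ} (hp : 1 < p) (δ : ℝ)
    (f : (Fin d → ℝ) → ℝ) {x y : Fin d → ℝ} (h : ‖y - x‖ ≤ rad x) :
    ENNReal.ofReal (jap x ^ ((δ + i) * p)) *
      ENNReal.ofReal (rad x ^ j * ‖iteratedFDeriv ℝ (i + j) f y‖) ^ p ≤
      ENNReal.ofReal (2 ^ ((|δ| + m) * p)) * Phi m p δ f y := by
  have hp0 : 0 < p := by linarith
  have hx := jap_pos x
  have hy := jap_pos y
  have hr := rad_pos hd x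
  refine le_trans ?_ (mul_le_mul_right (wt_le_Phi hij p δ f y) _)
  unfold wt
  have hrj : rad x ≤ jap x := by
    unfold rad
    refine mul_le_of_le_one_left hx.le ?_
    have : (1 : ℝ) ≤ d := by exact_mod_cast hd
    rw [div_le_one (by positivity)]
    linarith
  rw [ENNReal.ofReal_mul (by positivity), ENNReal.mul_rpow_of_nonneg _ _ hp0.le, ← mul_assoc,
    ← mul_assoc]
  refine mul_le_mul_left ?_ _
  rw [ENNReal.ofReal_rpow_of_nonneg (by positivity) hp0.le, ← ENNReal.ofReal_mul (by positivity),
    ← ENNReal.ofReal_mul (by positivity)]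
  apply ENNReal.ofReal_le_ofReal
  calc jap x ^ ((δ + i) * p) * (rad x ^ j) ^ p ≤ jap x ^ ((δ + i) * p) * (jap x ^ j) ^ p := by
        gcongr
    _ = jap x ^ ((δ + (i + j : ℕ)) * p) := by
        rw [← Real.rpow_natCast, ← Real.rpow_mul hx.le, ← Real.rpow_add hx]
        congr 1
        push_cast
        ring
    _ ≤ 2 ^ |(δ + (i + j : ℕ)) * p| * jap y ^ ((δ + (i + j : ℕ)) * p) := jap_rpow_comp hd h _
    _ ≤ _ := by
        gcongr
        · norm_num
        · rw [abs_mul, abs_of_pos hp0]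
          gcongr
          refine (abs_add_le _ _).trans ?_
          rw [abs_of_nonneg (by positivity : (0 : ℝ) ≤ ((i + j : ℕ) : ℝ))]
          gcongr

lemma wt_le_Avg (hd : 1 ≤ d) {m i : ℕ} (hi : i < m) {p ε : ℝ} (hp : 1 < p) (hε : 0 < ε) (δ : ℝ) :
    ∃ C : ℝ≥0∞, C ≠ ⊤ ∧ ∀ f : (Fin d → ℝ) → ℝ, ContDiff ℝ (⊤ : ℕ∞) f → ∀ x,
      wt p δ i f x ≤ C * Avg (((m - i : ℕ) : ℝ) * p - ε) (Phi m p δ f) x := by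
  have hp0 : 0 < p := by linarith
  obtain ⟨k, hk⟩ : ∃ k, m - i = k + 1 := ⟨m - i - 1, by omega⟩
  rw [hk]
  obtain ⟨C₁, hC₁, H₁⟩ := pointwise_bound (E := Fin d → ℝ)
    (F := ContinuousMultilinearMap ℝ (fun _ : Fin i => Fin d → ℝ) ℝ) k
  obtain ⟨C₂, hC₂, H₂⟩ := holder_weight (k + 1) p ε hp hε
  set C₃ : ℝ≥0∞ := (k + 2 : ℕ) ^ (p - 1) * ((k + 2 : ℕ) * ENNReal.ofReal (2 ^ ((|δ| + m) * p)))
    with hC₃d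
  have hC₃ : C₃ ≠ ⊤ := ENNReal.mul_ne_top
    (ENNReal.rpow_ne_top_of_nonneg (by linarith) (ENNReal.natCast_ne_top _))
    (ENNReal.mul_ne_top (ENNReal.natCast_ne_top _) ENNReal.ofReal_ne_top)
  refine ⟨ENNReal.ofReal C₁ ^ p * C₂ * C₃, ENNReal.mul_ne_top (ENNReal.mul_ne_top
    (ENNReal.rpow_ne_top_of_nonneg hp0.le ENNReal.ofReal_ne_top) hC₂) hC₃, ?_⟩
  intro f hf x
  have hr := rad_pos hd x
  have hu : ContDiff ℝ (⊤ : ℕ∞) (iteratedFDeriv ℝ i f) :=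
    hf.iteratedFDeriv_right (m := ((⊤ : ℕ∞) : WithTop ℕ∞)) (WithTop.coe_le_coe.2 (le_top : (⊤ : ℕ∞) + (i : ℕ∞) ≤ ⊤))
  have hPhi := Phi_meas m p δ hf
  set a : ℝ := ((k + 1 : ℕ) : ℝ) * p - ε with ha
  -- bound for each direction
  have key : ∀ v ∈ Metric.ball (0 : Fin d → ℝ) 1, wt p δ i f x ≤
      ENNReal.ofReal C₁ ^ p * C₂ * C₃ * ∫⁻ t in Set.Ioo (0 : ℝ) 1, ENNReal.ofReal (t ^ (a - 1)) *
        Phi m p δ f (x + (t * rad x) • v) := by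
    intro v hv
    have hv1 : ‖v‖ < 1 := by simpa using hv
    have hw : ‖rad x • v‖ ≤ rad x := by
      rw [norm_smul, Real.norm_of_nonneg hr.le]
      exact mul_le_of_le_one_right hr.le hv1.le
    have h1 := H₁ _ hu x (rad x • v) (rad x) hw
    set G : ℝ → ℝ := fun t => ∑ j ∈ Finset.range (k + 2), rad x ^ j *
      ‖iteratedFDeriv ℝ j (iteratedFDeriv ℝ i f) (x + t • rad x • v)‖ with hG
    have hGm : Measurable fun t => ENNReal.ofReal (G t) := by
      apply Measurable.ennreal_ofReal
      apply Continuous.measurable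
      refine continuous_finsetSum _ fun j _ => continuous_const.mul (Continuous.norm ?_)
      have := hu.continuous_iteratedFDeriv (m := j) (by exact_mod_cast le_top)
      exact this.comp (by fun_prop)
    have h2 := H₂ _ hGm
    have e1 : ∫⁻ t in Set.Ioo (0 : ℝ) 1, ENNReal.ofReal (t ^ (((k + 1 : ℕ) : ℝ) - 1)) *
        ENNReal.ofReal (G t) = ∫⁻ t in Set.Ioo (0 : ℝ) 1, ENNReal.ofReal (t ^ k) *
        ENNReal.ofReal (G t) := by
      have : (((k + 1 : ℕ) : ℝ) - 1) = (k : ℝ) := by push_cast; ring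
      rw [this]
      simp_rw [Real.rpow_natCast]
    rw [e1] at h2
    have h3 : ENNReal.ofReal ‖iteratedFDeriv ℝ i f x‖ ^ p ≤ ENNReal.ofReal C₁ ^ p *
        (C₂ * ∫⁻ t in Set.Ioo (0 : ℝ) 1, ENNReal.ofReal (t ^ (a - 1)) *
          ENNReal.ofReal (G t) ^ p) := by
      refine (ENNReal.rpow_le_rpow h1 hp0.le).trans ?_
      rw [ENNReal.mul_rpow_of_nonneg _ _ hp0.le]
      exact mul_le_mul_right h2 _
    have h4 : ∀ t ∈ Set.Ioo (0 : ℝ) 1, ENNReal.ofReal (jap x ^ ((δ + i) * p)) *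
        (ENNReal.ofReal (t ^ (a - 1)) * ENNReal.ofReal (G t) ^ p) ≤
        C₃ * (ENNReal.ofReal (t ^ (a - 1)) * Phi m p δ f (x + (t * rad x) • v)) := by
      intro t ht
      set y := x + (t * rad x) • v with hy
      have hyx : ‖y - x‖ ≤ rad x := by
        rw [hy, add_sub_cancel_left, mul_smul, norm_smul, Real.norm_of_nonneg ht.1.le]
        exact (mul_le_of_le_one_left (norm_nonneg _) ht.2.le).trans hw
      have h5 : ENNReal.ofReal (jap x ^ ((δ + i) * p)) * ENNReal.ofReal (G t) ^ p ≤
          C₃ * Phi m p δ f y := by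
        have hGe : ENNReal.ofReal (G t) = ∑ j ∈ Finset.range (k + 2),
            ENNReal.ofReal (rad x ^ j * ‖iteratedFDeriv ℝ (i + j) f y‖) := by
          rw [hG, ENNReal.ofReal_sum_of_nonneg (fun j _ => by positivity)]
          refine Finset.sum_congr rfl fun j _ => ?_
          rw [norm_iter_iter, hy, mul_smul]
        rw [hGe]
        refine (mul_le_mul_right (ENNReal.rpow_sum_le_const_mul_sum_rpow _ _ hp.le) _).trans ?_
        rw [mul_left_comm, Finset.card_range, hC₃d, mul_assoc]
        refine mul_le_mul_right ?_ _
        rw [Finset.mul_sum]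
        refine (Finset.sum_le_card_nsmul _ _ _ fun j hj => weight_shift hd
          (m := m) (by have := Finset.mem_range.1 hj; omega) hp δ f hyx).trans ?_
        rw [Finset.card_range, nsmul_eq_mul, mul_assoc]
      calc _ = ENNReal.ofReal (t ^ (a - 1)) *
            (ENNReal.ofReal (jap x ^ ((δ + i) * p)) * ENNReal.ofReal (G t) ^ p) := by ring
        _ ≤ ENNReal.ofReal (t ^ (a - 1)) * (C₃ * Phi m p δ f y) := mul_le_mul_right h5 _
        _ = _ := by ring
    have h6 := setLIntegral_mono' (μ := volume) measurableSet_Ioo h4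
    rw [lintegral_const_mul' _ _ ENNReal.ofReal_ne_top, lintegral_const_mul' _ _ hC₃] at h6
    unfold wt
    calc _ ≤ ENNReal.ofReal (jap x ^ ((δ + i) * p)) * (ENNReal.ofReal C₁ ^ p *
        (C₂ * ∫⁻ t in Set.Ioo (0 : ℝ) 1, ENNReal.ofReal (t ^ (a - 1)) *
          ENNReal.ofReal (G t) ^ p)) := mul_le_mul_right h3 _
      _ = ENNReal.ofReal C₁ ^ p * C₂ * (ENNReal.ofReal (jap x ^ ((δ + i) * p)) *
        ∫⁻ t in Set.Ioo (0 : ℝ) 1, ENNReal.ofReal (t ^ (a - 1)) *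
          ENNReal.ofReal (G t) ^ p) := by ring
      _ ≤ _ := mul_le_mul_right h6 _
      _ = _ := by ring
  -- average over directions
  have hvol : volume (Metric.ball (0 : Fin d → ℝ) 1) = ENNReal.ofReal (2 ^ d) := by
    rw [Real.volume_pi_ball _ one_pos]; simp
  have hle : wt p δ i f x ≤ ∫⁻ _v in Metric.ball (0 : Fin d → ℝ) 1, wt p δ i f x := by
    rw [setLIntegral_const, hvol]
    refine le_mul_of_one_le_right bot_le ?_
    rw [ENNReal.one_le_ofReal]
    exact one_le_pow₀ (by norm_num)
  refine hle.trans ((setLIntegral_mono' Metric.isOpen_ball.measurableSet key).trans ?_)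
  rw [lintegral_const_mul' _ _ (ENNReal.mul_ne_top (ENNReal.mul_ne_top
    (ENNReal.rpow_ne_top_of_nonneg hp0.le ENNReal.ofReal_ne_top) hC₂) hC₃)]
  refine mul_le_mul_right (le_of_eq ?_) _
  rw [lintegral_lintegral_swap]
  · unfold Avg
    refine setLIntegral_congr_fun measurableSet_Ioo fun t ht => ?_
    rw [lintegral_const_mul' _ _ ENNReal.ofReal_ne_top, avg_eq_ker hd ht.1 x hPhi]
  · apply Measurable.aemeasurable
    have : Measurable fun q : (Fin d → ℝ) × ℝ => x + (q.2 * rad x) • q.1 := by fun_prop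
    exact ((wt_meas _).comp measurable_snd).mul (hPhi.comp this)

lemma wt_prod (hd : 1 ≤ d) {m i l : ℕ} (hil : i + l ≤ m) {p : ℝ} (hp : 1 < p)
    (hm : (d : ℝ) / p < m) (δ₁ δ₂ : ℝ) :
    ∃ C : ℝ≥0∞, C ≠ ⊤ ∧ ∀ f g : (Fin d → ℝ) → ℝ, ContDiff ℝ (⊤ : ℕ∞) f → ContDiff ℝ (⊤ : ℕ∞) g →
      ∫⁻ x, ENNReal.ofReal (jap x ^ d) * (wt p δ₁ i f x * wt p δ₂ l g x) ≤
        C * ((∫⁻ x, Phi m p δ₁ f x) * ∫⁻ x, Phi m p δ₂ g x) := by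
  have hp0 : 0 < p := by linarith
  have hmp : (d : ℝ) < m * p := by rwa [div_lt_iff₀ hp0] at hm
  have hm0 : 0 < m := by
    rcases Nat.eq_zero_or_pos m with h | h
    · subst h
      have : (0 : ℝ) ≤ d := by positivity
      simp at hmp
      linarith
    · exact h
  obtain ⟨ε, hε, hε1, hε2⟩ : ∃ ε : ℝ, 0 < ε ∧ ε < 1 ∧ 2 * ε < m * p - d := by
    refine ⟨min (1 / 2) ((m * p - d) / 4), by apply lt_min <;> linarith, ?_, ?_⟩
    · exact (min_le_left _ _).trans_lt (by norm_num)
    · have := min_le_right (1 / 2 : ℝ) ((m * p - d) / 4)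
      linarith
  rcases Nat.lt_or_ge i m with hi | hi
  · obtain ⟨C₁, hC₁, H₁⟩ := wt_le_Avg hd hi hp hε δ₁
    rcases Nat.lt_or_ge l m with hl | hl
    · obtain ⟨C₂, hC₂, H₂⟩ := wt_le_Avg hd hl hp hε δ₂
      have hi1 : (1 : ℝ) ≤ ((m - i : ℕ) : ℝ) := by exact_mod_cast (by omega : 1 ≤ m - i)
      have hl1 : (1 : ℝ) ≤ ((m - l : ℕ) : ℝ) := by exact_mod_cast (by omega : 1 ≤ m - l)
      have hs : (m : ℝ) ≤ ((m - i : ℕ) : ℝ) + ((m - l : ℕ) : ℝ) := by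
        exact_mod_cast (by omega : m ≤ (m - i) + (m - l))
      obtain ⟨C₃, hC₃, H₃⟩ := Avg_bilin hd (a := ((m - i : ℕ) : ℝ) * p - ε)
        (b := ((m - l : ℕ) : ℝ) * p - ε) (by nlinarith) (by nlinarith) (by nlinarith)
      refine ⟨C₁ * C₂ * C₃, ENNReal.mul_ne_top (ENNReal.mul_ne_top hC₁ hC₂) hC₃, ?_⟩
      intro f g hf hg
      have h := H₃ _ _ (Phi_meas m p δ₁ hf) (Phi_meas m p δ₂ hg)
      rw [mul_assoc (C₁ * C₂)]
      refine le_trans ?_ (mul_le_mul_right h (C₁ * C₂))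
      rw [← lintegral_const_mul' _ _ (ENNReal.mul_ne_top hC₁ hC₂)]
      refine lintegral_mono fun x => ?_
      refine (mul_le_mul_right (mul_le_mul' (H₁ f hf x) (H₂ g hg x)) _).trans (le_of_eq ?_)
      ring
    · have hl' : l = m := by omega
      have hi' : i = 0 := by omega
      subst hl' hi'
      obtain ⟨C₃, hC₃, H₃⟩ := Avg_sup hd (b := ((l - 0 : ℕ) : ℝ) * p - ε)
        (by simp only [Nat.sub_zero]; linarith)
      refine ⟨C₁ * C₃, ENNReal.mul_ne_top hC₁ hC₃, ?_⟩
      intro f g hf hg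
      rw [← mul_assoc, ← lintegral_const_mul _ (Phi_meas l p δ₂ hg)]
      refine lintegral_mono fun x => ?_
      have h := H₃ _ (Phi_meas l p δ₁ hf) x
      calc _ ≤ ENNReal.ofReal (jap x ^ d) * (C₁ * Avg (((l - 0 : ℕ) : ℝ) * p - ε)
              (Phi l p δ₁ f) x * Phi l p δ₂ g x) :=
            mul_le_mul_right (mul_le_mul' (H₁ f hf x) (wt_le_Phi le_rfl _ _ _ _)) _
        _ = C₁ * (ENNReal.ofReal (jap x ^ d) * Avg (((l - 0 : ℕ) : ℝ) * p - ε)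
              (Phi l p δ₁ f) x) * Phi l p δ₂ g x := by ring
        _ ≤ C₁ * (C₃ * ∫⁻ x, Phi l p δ₁ f x) * Phi l p δ₂ g x :=
            mul_le_mul_left (mul_le_mul_right h _) _
        _ = _ := by ring
  · have hi' : i = m := by omega
    have hl' : l = 0 := by omega
    subst hl' hi'
    obtain ⟨C₂, hC₂, H₂⟩ := wt_le_Avg hd hm0 hp hε δ₂
    obtain ⟨C₃, hC₃, H₃⟩ := Avg_sup hd (b := ((i - 0 : ℕ) : ℝ) * p - ε)
      (by simp only [Nat.sub_zero]; linarith)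
    refine ⟨C₂ * C₃, ENNReal.mul_ne_top hC₂ hC₃, ?_⟩
    intro f g hf hg
    rw [mul_comm (∫⁻ x, Phi i p δ₁ f x), ← mul_assoc,
      ← lintegral_const_mul _ (Phi_meas i p δ₁ hf)]
    refine lintegral_mono fun x => ?_
    have h := H₃ _ (Phi_meas i p δ₂ hg) x
    calc _ ≤ ENNReal.ofReal (jap x ^ d) * (Phi i p δ₁ f x * (C₂ * Avg (((i - 0 : ℕ) : ℝ) * p - ε)
            (Phi i p δ₂ g) x)) :=
          mul_le_mul_right (mul_le_mul' (wt_le_Phi le_rfl _ _ _ _) (H₂ g hg x)) _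
      _ = C₂ * (ENNReal.ofReal (jap x ^ d) * Avg (((i - 0 : ℕ) : ℝ) * p - ε)
            (Phi i p δ₂ g) x) * Phi i p δ₁ f x := by ring
      _ ≤ C₂ * (C₃ * ∫⁻ x, Phi i p δ₂ g x) * Phi i p δ₁ f x :=
          mul_le_mul_left (mul_le_mul_right h _) _
      _ = _ := by ring

lemma wt_leibniz {p : ℝ} (hp : 1 < p) (δ₁ δ₂ : ℝ) (n : ℕ) :
    ∃ C : ℝ≥0∞, C ≠ ⊤ ∧ ∀ f g : (Fin d → ℝ) → ℝ, ContDiff ℝ (⊤ : ℕ∞) f → ContDiff ℝ (⊤ : ℕ∞) g →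
      ∀ x, wt p (δ₁ + δ₂ + (d : ℝ) / p) n (fun x => f x * g x) x ≤
        C * ∑ i ∈ Finset.range (n + 1),
          ENNReal.ofReal (jap x ^ d) * (wt p δ₁ i f x * wt p δ₂ (n - i) g x) := by
  have hp0 : 0 < p := by linarith
  refine ⟨(n + 1 : ℕ) ^ (p - 1) * ENNReal.ofReal (2 ^ n) ^ p, ENNReal.mul_ne_top
    (ENNReal.rpow_ne_top_of_nonneg (by linarith) (ENNReal.natCast_ne_top _))
    (ENNReal.rpow_ne_top_of_nonneg hp0.le ENNReal.ofReal_ne_top), ?_⟩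
  intro f g hf hg x
  have hx := jap_pos x
  have h1 := norm_iteratedFDeriv_mul_le hf hg x (n := n) (by exact_mod_cast le_top)
  unfold wt
  have h2 : ENNReal.ofReal ‖iteratedFDeriv ℝ n (fun x => f x * g x) x‖ ≤
      ∑ i ∈ Finset.range (n + 1), ENNReal.ofReal (2 ^ n) *
        (ENNReal.ofReal ‖iteratedFDeriv ℝ i f x‖ *
          ENNReal.ofReal ‖iteratedFDeriv ℝ (n - i) g x‖) := by
    refine (ENNReal.ofReal_le_ofReal h1).trans ?_
    rw [ENNReal.ofReal_sum_of_nonneg (fun j _ => by positivity)]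
    refine Finset.sum_le_sum fun i hi => ?_
    rw [← ENNReal.ofReal_mul (by positivity), ← ENNReal.ofReal_mul (by positivity), mul_assoc]
    apply ENNReal.ofReal_le_ofReal
    gcongr
    exact_mod_cast Nat.choose_le_two_pow n i
  have h3 := (ENNReal.rpow_le_rpow h2 hp0.le).trans
    (ENNReal.rpow_sum_le_const_mul_sum_rpow _ _ hp.le)
  refine (mul_le_mul_right h3 _).trans (le_of_eq ?_)
  rw [Finset.card_range, mul_left_comm, mul_assoc]
  congr 1
  rw [Finset.mul_sum, Finset.mul_sum]
  refine Finset.sum_congr rfl fun i hi => ?_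
  have hin : i ≤ n := by have := Finset.mem_range.1 hi; omega
  have e : ENNReal.ofReal (jap x ^ ((δ₁ + δ₂ + (d : ℝ) / p + n) * p)) =
      ENNReal.ofReal (jap x ^ d) * (ENNReal.ofReal (jap x ^ ((δ₁ + i) * p)) *
        ENNReal.ofReal (jap x ^ ((δ₂ + (n - i : ℕ)) * p))) := by
    rw [← ENNReal.ofReal_mul (by positivity), ← ENNReal.ofReal_mul (by positivity),
      ← Real.rpow_natCast, ← Real.rpow_add hx, ← Real.rpow_add hx, Nat.cast_sub hin]
    congr 2
    field_simp
    ring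
  rw [e, ENNReal.mul_rpow_of_nonneg _ _ hp0.le, ENNReal.mul_rpow_of_nonneg _ _ hp0.le]
  ring

lemma wt_main (hd : 1 ≤ d) {m n : ℕ} (hn : n ≤ m) {p : ℝ} (hp : 1 < p)
    (hm : (d : ℝ) / p < m) (δ₁ δ₂ : ℝ) :
    ∃ C : ℝ≥0∞, C ≠ ⊤ ∧ ∀ f g : (Fin d → ℝ) → ℝ, ContDiff ℝ (⊤ : ℕ∞) f → ContDiff ℝ (⊤ : ℕ∞) g →
      ∫⁻ x, wt p (δ₁ + δ₂ + (d : ℝ) / p) n (fun x => f x * g x) x ≤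
        C * ((∫⁻ x, Phi m p δ₁ f x) * ∫⁻ x, Phi m p δ₂ g x) := by
  obtain ⟨C₀, hC₀, H₀⟩ := wt_leibniz (d := d) hp δ₁ δ₂ n
  have H : ∀ i ∈ Finset.range (n + 1), ∃ C : ℝ≥0∞, C ≠ ⊤ ∧ ∀ f g : (Fin d → ℝ) → ℝ,
      ContDiff ℝ (⊤ : ℕ∞) f → ContDiff ℝ (⊤ : ℕ∞) g →
      ∫⁻ x, ENNReal.ofReal (jap x ^ d) * (wt p δ₁ i f x * wt p δ₂ (n - i) g x) ≤
        C * ((∫⁻ x, Phi m p δ₁ f x) * ∫⁻ x, Phi m p δ₂ g x) := fun i hi =>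
    wt_prod hd (by have := Finset.mem_range.1 hi; omega) hp hm δ₁ δ₂
  choose! C hC HC using H
  refine ⟨C₀ * ∑ i ∈ Finset.range (n + 1), C i, ENNReal.mul_ne_top hC₀
    (ENNReal.sum_ne_top.2 hC), ?_⟩
  intro f g hf hg
  refine (lintegral_mono (H₀ f g hf hg)).trans ?_
  rw [lintegral_const_mul' _ _ hC₀, lintegral_finsetSum, mul_assoc]
  · refine mul_le_mul_right ?_ _
    rw [Finset.sum_mul]
    exact Finset.sum_le_sum fun i hi => HC i hi f g hf hg
  · intro i _
    have h1 := wt_meas' p δ₁ i hf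
    have h2 := wt_meas' p δ₂ (n - i) hg
    have h3 := (jap_cont (d := d)).measurable
    fun_prop

end


section bridge
variable {d : ℕ}

noncomputable def trm (p δ : ℝ) (α : Fin d → ℕ) (f : (Fin d → ℝ) → ℝ) (x : Fin d → ℝ) : ℝ :=
  jap x ^ ((δ + ((∑ j, (α j : ℕ) : ℕ) : ℝ)) * p) * |pdm α f x| ^ p

lemma trm_nonneg (p δ : ℝ) (α : Fin d → ℕ) (f : (Fin d → ℝ) → ℝ) (x : Fin d → ℝ) :
    0 ≤ trm p δ α f x :=
  mul_nonneg (Real.rpow_nonneg (jap_pos x).le _) (Real.rpow_nonneg (abs_nonneg _) _)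

lemma trm_cont {p : ℝ} (hp : 0 < p) (δ : ℝ) (α : Fin d → ℕ) {f : (Fin d → ℝ) → ℝ}
    (hf : ContDiff ℝ (⊤ : ℕ∞) f) : Continuous (trm p δ α f) := by
  unfold trm
  have h2 : Continuous (pdm α f) := by
    rw [pdm_eq]; exact (pdl_smooth _ hf).continuous
  refine Continuous.mul ?_ ?_
  · exact jap_cont.rpow_const fun x => Or.inl (jap_pos x).ne'
  · exact h2.abs.rpow_const fun x => Or.inr hp.le

lemma trm_supp {p : ℝ} (hp : 0 < p) (δ : ℝ) (α : Fin d → ℕ) {f : (Fin d → ℝ) → ℝ}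
    (hf : ContDiff ℝ (⊤ : ℕ∞) f) (hc : HasCompactSupport f) :
    HasCompactSupport (trm p δ α f) := by
  refine (hc.iteratedFDeriv (𝕜 := ℝ) (∑ j, α j)).mono fun x hx => ?_
  rw [Function.mem_support] at hx ⊢
  intro h0
  apply hx
  have h1 := norm_pdm_le α hf x
  rw [h0, norm_zero] at h1
  have h2 : |pdm α f x| = 0 := le_antisymm h1 (abs_nonneg _)
  simp [trm, h2, Real.zero_rpow hp.ne']

lemma trm_lint {p : ℝ} (hp : 0 < p) (δ : ℝ) (α : Fin d → ℕ) {f : (Fin d → ℝ) → ℝ}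
    (hf : ContDiff ℝ (⊤ : ℕ∞) f) (hc : HasCompactSupport f) :
    ENNReal.ofReal (∫ x, trm p δ α f x) = ∫⁻ x, ENNReal.ofReal (trm p δ α f x) :=
  ofReal_integral_eq_lintegral_ofReal
    ((trm_cont hp δ α hf).integrable_of_hasCompactSupport (trm_supp hp δ α hf hc))
    (Filter.Eventually.of_forall fun x => trm_nonneg p δ α f x)

lemma wnorm_eq (m : ℕ) (p δ : ℝ) (f : (Fin d → ℝ) → ℝ) :
    wnorm d m p δ f = ∑ β : Fin d → Fin (m + 1), if (∑ j, (β j : ℕ)) ≤ m then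
      (∫ x, trm p δ (fun j => (β j : ℕ)) f x) ^ (1 / p) else 0 := by
  unfold wnorm trm
  push_cast
  rfl

lemma trm_int_nonneg (p δ : ℝ) (α : Fin d → ℕ) (f : (Fin d → ℝ) → ℝ) :
    0 ≤ ∫ x, trm p δ α f x := integral_nonneg fun x => trm_nonneg p δ α f x

lemma wnorm_nonneg (m : ℕ) (p δ : ℝ) (f : (Fin d → ℝ) → ℝ) : 0 ≤ wnorm d m p δ f := by
  rw [wnorm_eq]
  refine Finset.sum_nonneg fun β _ => ?_
  split_ifs
  · exact Real.rpow_nonneg (trm_int_nonneg _ _ _ _) _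
  · exact le_rfl

lemma trm_int_le {m : ℕ} {p : ℝ} (hp : 0 < p) (δ : ℝ) (α : Fin d → ℕ) (hα : ∑ j, α j ≤ m)
    (f : (Fin d → ℝ) → ℝ) : ∫ x, trm p δ α f x ≤ wnorm d m p δ f ^ p := by
  have hj : ∀ j, α j < m + 1 := fun j =>
    Nat.lt_succ_of_le ((Finset.single_le_sum (f := α) (fun _ _ => Nat.zero_le _)
      (Finset.mem_univ j)).trans hα)
  have h : (∫ x, trm p δ α f x) ^ (1 / p) ≤ wnorm d m p δ f := by
    rw [wnorm_eq]
    have := Finset.single_le_sum (s := Finset.univ)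
      (f := fun β : Fin d → Fin (m + 1) => if (∑ j, (β j : ℕ)) ≤ m then
        (∫ x, trm p δ (fun j => (β j : ℕ)) f x) ^ (1 / p) else 0)
      (fun β _ => by
        split_ifs
        · exact Real.rpow_nonneg (trm_int_nonneg _ _ _ _) _
        · exact le_rfl) (Finset.mem_univ (fun j => ⟨α j, hj j⟩))
    dsimp only at this
    rwa [if_pos hα] at this
  calc ∫ x, trm p δ α f x = ((∫ x, trm p δ α f x) ^ (1 / p)) ^ p := by
        rw [← Real.rpow_mul (trm_int_nonneg _ _ _ _), one_div_mul_cancel hp.ne', Real.rpow_one]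
    _ ≤ _ := Real.rpow_le_rpow (Real.rpow_nonneg (trm_int_nonneg _ _ _ _) _) h hp.le

lemma ofReal_trm {p : ℝ} (hp : 0 < p) (δ : ℝ) (α : Fin d → ℕ) (f : (Fin d → ℝ) → ℝ)
    (x : Fin d → ℝ) : ENNReal.ofReal (trm p δ α f x) =
      ENNReal.ofReal (jap x ^ ((δ + ((∑ j, (α j : ℕ) : ℕ) : ℝ)) * p)) *
        ENNReal.ofReal |pdm α f x| ^ p := by
  unfold trm
  rw [ENNReal.ofReal_mul (Real.rpow_nonneg (jap_pos x).le _),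
    ENNReal.ofReal_rpow_of_nonneg (abs_nonneg _) hp.le]

lemma wt_lint_le {m n : ℕ} (hn : n ≤ m) {p : ℝ} (hp : 1 < p) (δ : ℝ) :
    ∃ C : ℝ≥0∞, C ≠ ⊤ ∧ ∀ f : (Fin d → ℝ) → ℝ, ContDiff ℝ (⊤ : ℕ∞) f → HasCompactSupport f →
      ∫⁻ x, wt p δ n f x ≤ C * ENNReal.ofReal (wnorm d m p δ f ^ p) := by
  have hp0 : 0 < p := by linarith
  set N : ℕ := Fintype.card (Fin n → Fin d) with hN
  refine ⟨(N : ℝ≥0∞) ^ (p - 1) * N, ENNReal.mul_ne_top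
    (ENNReal.rpow_ne_top_of_nonneg (by linarith) (ENNReal.natCast_ne_top _))
    (ENNReal.natCast_ne_top _), ?_⟩
  intro f hf hc
  have hpt : ∀ x, wt p δ n f x ≤ (N : ℝ≥0∞) ^ (p - 1) * ∑ σ : Fin n → Fin d,
      ENNReal.ofReal (trm p δ (fun j => (List.ofFn σ).count j) f x) := by
    intro x
    have h1 : ENNReal.ofReal ‖iteratedFDeriv ℝ n f x‖ ^ p ≤ (N : ℝ≥0∞) ^ (p - 1) *
        ∑ σ : Fin n → Fin d, ENNReal.ofReal |pdm (fun j => (List.ofFn σ).count j) f x| ^ p := by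
      have h2 := ENNReal.rpow_sum_le_const_mul_sum_rpow (Finset.univ : Finset (Fin n → Fin d))
        (fun σ => ENNReal.ofReal |pdm (fun j => (List.ofFn σ).count j) f x|) hp.le
      rw [Finset.card_univ] at h2
      refine le_trans (ENNReal.rpow_le_rpow ?_ hp0.le) h2
      rw [← ENNReal.ofReal_sum_of_nonneg fun _ _ => abs_nonneg _]
      exact ENNReal.ofReal_le_ofReal (norm_iter_le hf x)
    unfold wt
    refine (mul_le_mul_right h1 _).trans (le_of_eq ?_)
    rw [mul_left_comm, Finset.mul_sum]
    congr 1
    refine Finset.sum_congr rfl fun σ _ => ?_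
    rw [ofReal_trm hp0, count_sum]
  refine (lintegral_mono hpt).trans ?_
  have hmeas : ∀ σ : Fin n → Fin d, Measurable fun x =>
      ENNReal.ofReal (trm p δ (fun j => (List.ofFn σ).count j) f x) := fun σ =>
    (trm_cont hp0 δ _ hf).measurable.ennreal_ofReal
  rw [lintegral_const_mul _ (Finset.measurable_fun_sum _ fun σ _ => hmeas σ),
    lintegral_finsetSum _ fun σ _ => hmeas σ, mul_assoc]
  refine mul_le_mul_right ?_ _
  calc _ ≤ ∑ σ : Fin n → Fin d, ENNReal.ofReal (wnorm d m p δ f ^ p) := by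
        refine Finset.sum_le_sum fun σ _ => ?_
        rw [← trm_lint hp0 δ _ hf hc]
        exact ENNReal.ofReal_le_ofReal (trm_int_le hp0 δ _ (by rw [count_sum]; exact hn) f)
    _ = _ := by
        rw [Finset.sum_const, Finset.card_univ, nsmul_eq_mul]

lemma Phi_lint_le (m : ℕ) {p : ℝ} (hp : 1 < p) (δ : ℝ) :
    ∃ C : ℝ≥0∞, C ≠ ⊤ ∧ ∀ f : (Fin d → ℝ) → ℝ, ContDiff ℝ (⊤ : ℕ∞) f → HasCompactSupport f →
      ∫⁻ x, Phi m p δ f x ≤ C * ENNReal.ofReal (wnorm d m p δ f ^ p) := by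
  have H : ∀ n ∈ Finset.range (m + 1), ∃ C : ℝ≥0∞, C ≠ ⊤ ∧ ∀ f : (Fin d → ℝ) → ℝ,
      ContDiff ℝ (⊤ : ℕ∞) f → HasCompactSupport f →
      ∫⁻ x, wt p δ n f x ≤ C * ENNReal.ofReal (wnorm d m p δ f ^ p) := fun n hn =>
    wt_lint_le (by have := Finset.mem_range.1 hn; omega) hp δ
  choose! C hC H using H
  refine ⟨∑ n ∈ Finset.range (m + 1), C n, (ENNReal.sum_lt_top.2 fun n hn =>
    (hC n hn).lt_top).ne, fun f hf hc => ?_⟩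
  unfold Phi
  rw [lintegral_finsetSum _ fun n _ => wt_meas' p δ n hf, Finset.sum_mul]
  exact Finset.sum_le_sum fun n hn => H n hn f hf hc

end bridge

theorem stmt1 (d m : ℕ) (hd : 1 ≤ d) (p : ℝ) (hp : 1 < p) (δ₁ δ₂ : ℝ)
    (hm : (d : ℝ) / p < m) :
    ∃ C > 0, ∀ f g : (Fin d → ℝ) → ℝ,
      ContDiff ℝ (⊤ : ℕ∞) f → HasCompactSupport f → ContDiff ℝ (⊤ : ℕ∞) g → HasCompactSupport g →
        wnorm d m p (δ₁ + δ₂ + (d : ℝ) / p) (fun x => f x * g x) ≤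
          C * wnorm d m p δ₁ f * wnorm d m p δ₂ g := by
  have hp0 : 0 < p := by linarith
  obtain ⟨A, hA, HA⟩ := Phi_lint_le (d := d) m hp δ₁
  obtain ⟨B, hB, HB⟩ := Phi_lint_le (d := d) m hp δ₂
  have H : ∀ n, n ≤ m → ∃ K : ℝ, 0 ≤ K ∧ ∀ f g : (Fin d → ℝ) → ℝ,
      ContDiff ℝ (⊤ : ℕ∞) f → HasCompactSupport f → ContDiff ℝ (⊤ : ℕ∞) g → HasCompactSupport g →
      ∫⁻ x, wt p (δ₁ + δ₂ + (d : ℝ) / p) n (fun x => f x * g x) x ≤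
        ENNReal.ofReal (K * (wnorm d m p δ₁ f * wnorm d m p δ₂ g) ^ p) := by
    intro n hn
    obtain ⟨C, hC, HC⟩ := wt_main hd hn hp hm δ₁ δ₂
    refine ⟨(C * (A * B)).toReal, ENNReal.toReal_nonneg, fun f g hf hfc hg hgc => ?_⟩
    have hne : C * (A * B) ≠ ⊤ := ENNReal.mul_ne_top hC (ENNReal.mul_ne_top hA hB)
    rw [ENNReal.ofReal_mul ENNReal.toReal_nonneg, ENNReal.ofReal_toReal hne,
      Real.mul_rpow (wnorm_nonneg _ _ _ _) (wnorm_nonneg _ _ _ _),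
      ENNReal.ofReal_mul (Real.rpow_nonneg (wnorm_nonneg _ _ _ _) _)]
    refine (HC f g hf hg).trans ?_
    refine (mul_le_mul_right (mul_le_mul' (HA f hf hfc) (HB g hg hgc)) C).trans (le_of_eq ?_)
    ring
  choose! K hK HK using H
  have hterm : ∀ α : Fin d → ℕ, ∑ j, α j ≤ m → ∀ f g : (Fin d → ℝ) → ℝ,
      ContDiff ℝ (⊤ : ℕ∞) f → HasCompactSupport f → ContDiff ℝ (⊤ : ℕ∞) g → HasCompactSupport g →
      (∫ x, trm p (δ₁ + δ₂ + (d : ℝ) / p) α (fun x => f x * g x) x) ^ (1 / p) ≤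
        K (∑ j, α j) ^ (1 / p) * (wnorm d m p δ₁ f * wnorm d m p δ₂ g) := by
    intro α hα f g hf hfc hg hgc
    have hfg : ContDiff ℝ (⊤ : ℕ∞) (fun x => f x * g x) := hf.mul hg
    have hfgc : HasCompactSupport (fun x => f x * g x) := hfc.mul_right
    have hw : 0 ≤ wnorm d m p δ₁ f * wnorm d m p δ₂ g :=
      mul_nonneg (wnorm_nonneg _ _ _ _) (wnorm_nonneg _ _ _ _)
    have h1 : ENNReal.ofReal (∫ x, trm p (δ₁ + δ₂ + (d : ℝ) / p) α (fun x => f x * g x) x) ≤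
        ENNReal.ofReal (K (∑ j, α j) * (wnorm d m p δ₁ f * wnorm d m p δ₂ g) ^ p) := by
      rw [trm_lint hp0 _ _ hfg hfgc]
      refine le_trans (lintegral_mono fun x => ?_) (HK _ hα f g hf hfc hg hgc)
      rw [ofReal_trm hp0]
      unfold wt
      exact mul_le_mul_right (ENNReal.rpow_le_rpow
        (ENNReal.ofReal_le_ofReal (norm_pdm_le α hfg x)) hp0.le) _
    have h2 := (ENNReal.ofReal_le_ofReal_iff
      (mul_nonneg (hK _ hα) (Real.rpow_nonneg hw _))).1 h1
    refine (Real.rpow_le_rpow (trm_int_nonneg _ _ _ _) h2 (by positivity)).trans (le_of_eq ?_)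
    rw [Real.mul_rpow (hK _ hα) (Real.rpow_nonneg hw _), ← Real.rpow_mul hw,
      mul_one_div_cancel hp0.ne', Real.rpow_one]
  set S : ℝ := ∑ β : Fin d → Fin (m + 1), if (∑ j, (β j : ℕ)) ≤ m then
      K (∑ j, (β j : ℕ)) ^ (1 / p) else 0 with hS
  have hS0 : 0 ≤ S := by
    refine Finset.sum_nonneg fun β _ => ?_
    split_ifs with h
    · exact Real.rpow_nonneg (hK _ h) _
    · exact le_rfl
  refine ⟨S + 1, by linarith, fun f g hf hfc hg hgc => ?_⟩
  have hw : 0 ≤ wnorm d m p δ₁ f * wnorm d m p δ₂ g :=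
    mul_nonneg (wnorm_nonneg _ _ _ _) (wnorm_nonneg _ _ _ _)
  have hle : wnorm d m p (δ₁ + δ₂ + (d : ℝ) / p) (fun x => f x * g x) ≤
      S * (wnorm d m p δ₁ f * wnorm d m p δ₂ g) := by
    rw [wnorm_eq, hS, Finset.sum_mul]
    refine Finset.sum_le_sum fun β _ => ?_
    split_ifs with h
    · exact hterm _ h f g hf hfc hg hgc
    · simp
  rw [mul_assoc]
  nlinarith
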